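/- arXiv:2308.06297 — 2 statements merged into one kernel-verified Lean document; each statement's English description precedes it below -/
import Mathlib

section
/- The Weierstrass function W : ℝ → ℝ defined by W(x) = ∑_{n=0}^{∞} cos(21ⁿ π x) / 3ⁿ is continuous at every point of ℝ and differentiable at no point of ℝ. -/
/-- The Weierstrass function `W x = ∑_{n=0}^∞ cos(21ⁿ π x) / 3ⁿ`. -/
noncomputable def weierstrass : ℝ → ℝ := fun x =>
  ∑' n : ℕ, Real.cos (21 ^ n * Real.pi * x) / 3 ^ n

theorem w_summable (x : ℝ) :
    Summable (fun n : ℕ => Real.cos (21 ^ n * Real.pi * x) / 3 ^ n) := by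
  refine Summable.of_norm_bounded (g := fun n : ℕ => (1/3 : ℝ) ^ n)
    (summable_geometric_of_lt_one (by norm_num) (by norm_num)) ?_
  intro n
  rw [norm_div, Real.norm_eq_abs, norm_pow, one_div, inv_pow, div_eq_mul_inv]
  have := Real.abs_cos_le_one (21 ^ n * Real.pi * x)
  have h3 : ‖(3:ℝ)‖ = 3 := by norm_num
  rw [h3]
  exact mul_le_of_le_one_left (by positivity) this

theorem w_cont : Continuous weierstrass := by
  unfold weierstrass
  refine continuous_tsum (u := fun n : ℕ => (1/3 : ℝ) ^ n) (fun n => by fun_prop)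
    (summable_geometric_of_lt_one (by norm_num) (by norm_num)) ?_
  intro n x
  rw [norm_div, Real.norm_eq_abs, norm_pow, one_div, inv_pow, div_eq_mul_inv]
  have := Real.abs_cos_le_one (21 ^ n * Real.pi * x)
  have h3 : ‖(3:ℝ)‖ = 3 := by norm_num
  rw [h3]
  exact mul_le_of_le_one_left (by positivity) this

theorem w_cos (k : ℤ) (j : ℕ) (t : ℝ) :
    Real.cos (21 ^ j * Real.pi * (k + t)) = (-1) ^ k * Real.cos (21 ^ j * Real.pi * t) := by
  have h := Real.cos_add_int_mul_pi (21 ^ j * Real.pi * t) (21 ^ j * k)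
  have e : ((-1 : ℝ)) ^ ((21 : ℤ) ^ j * k) = (-1) ^ k := by
    rw [zpow_mul]
    congr 1
    have : Odd ((21 : ℤ) ^ j) := Odd.pow (by decide)
    exact this.neg_one_zpow
  rw [e] at h
  rw [← h]
  congr 1
  push_cast
  ring

theorem w_head (m : ℕ) (x y : ℝ) :
    |∑ n ∈ Finset.range m, (Real.cos (21 ^ n * Real.pi * y) / 3 ^ n
      - Real.cos (21 ^ n * Real.pi * x) / 3 ^ n)| ≤ Real.pi * |y - x| * (7 ^ m / 6) := by
  have h1 : ∀ n : ℕ, |Real.cos (21 ^ n * Real.pi * y) / 3 ^ n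
      - Real.cos (21 ^ n * Real.pi * x) / 3 ^ n| ≤ Real.pi * |y - x| * 7 ^ n := by
    intro n
    have hc : |Real.cos (21 ^ n * Real.pi * y) - Real.cos (21 ^ n * Real.pi * x)|
        ≤ |21 ^ n * Real.pi * y - 21 ^ n * Real.pi * x| := by
      exact Real.abs_cos_sub_cos_le _ _
    rw [← sub_div, abs_div, abs_of_pos (by positivity : (0:ℝ) < 3 ^ n),
      div_le_iff₀ (by positivity)]
    refine hc.trans (le_of_eq ?_)
    rw [← mul_sub, abs_mul, abs_of_pos (by positivity : (0:ℝ) < 21 ^ n * Real.pi),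
      show (21:ℝ) = 7 * 3 by norm_num, mul_pow]
    ring
  refine (Finset.abs_sum_le_sum_abs _ _).trans ((Finset.sum_le_sum fun n _ => h1 n).trans ?_)
  rw [← Finset.mul_sum, geom_sum_eq (by norm_num)]
  refine mul_le_mul_of_nonneg_left ?_ (by positivity)
  linarith [pow_pos (by norm_num : (0:ℝ) < 7) m]

theorem w_tail (m : ℕ) (k : ℤ) (t : ℝ) (ht : |t| ≤ 1 / 2) (x y : ℝ)
    (hx : 21 ^ m * x = k + t) (hy : 21 ^ m * y = k + 1) :
    1 / 3 ^ m ≤ |∑' n : ℕ, (Real.cos (21 ^ (n + m) * Real.pi * y) / 3 ^ (n + m)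
      - Real.cos (21 ^ (n + m) * Real.pi * x) / 3 ^ (n + m))| := by
  set F : ℕ → ℝ := fun n => (Real.cos (21 ^ (n + m) * Real.pi * y) / 3 ^ (n + m)
      - Real.cos (21 ^ (n + m) * Real.pi * x) / 3 ^ (n + m)) with hF
  have hs : Summable F :=
    ((summable_nat_add_iff m).2 (w_summable y)).sub ((summable_nat_add_iff m).2 (w_summable x))
  have hsq : ((-1:ℝ) ^ k) * (-1) ^ k = 1 := by
    rw [← mul_zpow]; norm_num
  have habs : |(-1:ℝ) ^ k| = 1 := by
    rw [abs_zpow]; norm_num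
  have hf : ∀ n, -(-1:ℝ) ^ k * F n = (1 + Real.cos (21 ^ n * Real.pi * t)) / 3 ^ (n + m) := by
    intro n
    have e1 : Real.cos (21 ^ (n + m) * Real.pi * x)
        = (-1) ^ k * Real.cos (21 ^ n * Real.pi * t) := by
      rw [← w_cos, ← hx]; congr 1; ring
    have e2 : Real.cos (21 ^ (n + m) * Real.pi * y) = -(-1) ^ k := by
      have := w_cos (k + 1) n 0
      rw [mul_zero, Real.cos_zero, mul_one, zpow_add_one₀ (by norm_num)] at this
      rw [show (21:ℝ) ^ (n + m) * Real.pi * y = 21 ^ n * Real.pi * (((k + 1 : ℤ) : ℝ) + 0) by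
        push_cast; rw [add_zero, ← hy]; ring, this]
      ring
    simp only [hF, e1, e2]
    linear_combination ((1 + Real.cos (21 ^ n * Real.pi * t)) / 3 ^ (n + m)) * hsq
  have hs' : Summable (fun n => -(-1:ℝ) ^ k * F n) := hs.mul_left _
  have hle : -(-1:ℝ) ^ k * F 0 ≤ ∑' n, -(-1:ℝ) ^ k * F n := by
    refine hs'.le_tsum 0 (fun n _ => ?_)
    rw [hf]
    have := Real.neg_one_le_cos (21 ^ n * Real.pi * t)
    exact div_nonneg (by linarith) (by positivity)
  rw [tsum_mul_left, hf 0] at hle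
  have hc : 0 ≤ Real.cos (21 ^ 0 * Real.pi * t) := by
    have := abs_le.1 ht
    have := Real.pi_pos
    apply Real.cos_nonneg_of_neg_pi_div_two_le_of_le <;> nlinarith
  have h2 : 1 / 3 ^ m ≤ (1 + Real.cos (21 ^ 0 * Real.pi * t)) / 3 ^ (0 + m) := by
    rw [zero_add]
    gcongr
    linarith
  refine (h2.trans hle).trans ((le_abs_self _).trans (le_of_eq ?_))
  rw [abs_mul, abs_neg, habs, one_mul]

theorem w_main (x : ℝ) (m : ℕ) : ∃ y : ℝ, |y - x| ≤ 3 / 2 * (1 / 21) ^ m ∧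
    1 / 5 * (1 / 3) ^ m ≤ |weierstrass y - weierstrass x| := by
  have hp : (0:ℝ) < 21 ^ m := by positivity
  have ht : |21 ^ m * x - round (21 ^ m * x)| ≤ 1 / 2 := abs_sub_round _
  obtain ⟨k, hk⟩ : ∃ k : ℤ, k = round ((21:ℝ) ^ m * x) := ⟨_, rfl⟩
  rw [← hk] at ht
  have hy : (21:ℝ) ^ m * (((k:ℝ) + 1) / 21 ^ m) = k + 1 := by field_simp
  generalize ((k:ℝ) + 1) / 21 ^ m = y at hy
  have hh : |y - x| ≤ 3 / 2 * (1 / 21) ^ m := by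
    rw [one_div_pow, mul_one_div, le_div_iff₀ hp, ← abs_of_pos hp, ← abs_mul]
    have := abs_le.1 ht
    rw [abs_le]
    constructor <;> nlinarith
  refine ⟨y, hh, ?_⟩
  have htail := w_tail m k _ ht x y (by ring) hy
  have hhead := w_head m x y
  have hd : weierstrass y - weierstrass x = ∑' n : ℕ, (Real.cos (21 ^ n * Real.pi * y) / 3 ^ n
      - Real.cos (21 ^ n * Real.pi * x) / 3 ^ n) :=
    ((w_summable y).tsum_sub (w_summable x)).symm
  rw [← ((w_summable y).sub (w_summable x)).sum_add_tsum_nat_add m] at hd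
  rw [hd]
  have hb : Real.pi * |y - x| * (7 ^ m / 6) ≤ 4 / 5 * (1 / 3) ^ m := by
    have e : ((1:ℝ) / 3) ^ m = (1 / 21) ^ m * 7 ^ m := by rw [← mul_pow]; norm_num
    have hpi : Real.pi ≤ 3.15 := Real.pi_lt_d2.le
    calc Real.pi * |y - x| * (7 ^ m / 6)
        ≤ 3.15 * (3 / 2 * (1 / 21) ^ m) * (7 ^ m / 6) := by gcongr
      _ = (3.15 / 4) * (1 / 3) ^ m := by rw [e]; ring
      _ ≤ 4 / 5 * (1 / 3) ^ m := mul_le_mul_of_nonneg_right (by norm_num) (by positivity)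
  rw [← one_div_pow] at htail
  have := abs_sub_abs_le_abs_add (∑' n : ℕ, (Real.cos (21 ^ (n + m) * Real.pi * y) / 3 ^ (n + m)
      - Real.cos (21 ^ (n + m) * Real.pi * x) / 3 ^ (n + m)))
      (∑ n ∈ Finset.range m, (Real.cos (21 ^ n * Real.pi * y) / 3 ^ n
      - Real.cos (21 ^ n * Real.pi * x) / 3 ^ n))
  rw [add_comm (∑' n : ℕ, _)] at this
  linarith

/-- The Weierstrass function is continuous at every point of `ℝ` and differentiable at no
point of `ℝ`. -/
theorem stmt_9 :
    (∀ x : ℝ, ContinuousAt weierstrass x) ∧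
    (∀ x : ℝ, ¬ DifferentiableAt ℝ weierstrass x) := by
  refine ⟨fun x => w_cont.continuousAt, fun x hx => ?_⟩
  obtain ⟨C, hC0, hC⟩ := hx.isBigO_sub.exists_pos
  have hC := hC.bound
  choose y hy1 hy2 using w_main x
  have h0 : Filter.Tendsto (fun m : ℕ => (3:ℝ) / 2 * (1 / 21) ^ m) Filter.atTop (nhds 0) := by
    simpa using (tendsto_pow_atTop_nhds_zero_of_lt_one (by norm_num : (0:ℝ) ≤ 1 / 21)
      (by norm_num)).const_mul (3 / 2 : ℝ)
  have hlim : Filter.Tendsto y Filter.atTop (nhds x) := by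
    rw [tendsto_iff_dist_tendsto_zero]
    exact squeeze_zero (fun _ => dist_nonneg) (fun m => by rw [Real.dist_eq]; exact hy1 m) h0
  have h7 := (tendsto_pow_atTop_atTop_of_one_lt (by norm_num : (1:ℝ) < 7)).eventually_gt_atTop
    (15 / 2 * C)
  obtain ⟨m, hm1, hm2⟩ := ((hlim.eventually hC).and h7).exists
  rw [Real.norm_eq_abs, Real.norm_eq_abs] at hm1
  have e : ((1:ℝ) / 3) ^ m = (1 / 21) ^ m * 7 ^ m := by rw [← mul_pow]; norm_num
  have h1 := hy2 m
  have h2 := mul_le_mul_of_nonneg_left (hy1 m) hC0.le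
  have hp : (0:ℝ) < (1 / 21) ^ m := by positivity
  rw [e] at h1
  have h3 := mul_lt_mul_of_pos_left hm2 hp
  nlinarith
end

section
/- The dimension of the real vector space of all functions from ℝ to ℝ (with pointwise addition and scalar multiplication) equals 2^𝔠; that is, the rank of ℝ → ℝ as an ℝ-module is 2^𝔠. -/
/-- The dimension of the real vector space of all functions `ℝ → ℝ` (with pointwise
operations) equals `2 ^ 𝔠`. -/
theorem stmt_16 :
    Module.rank ℝ (ℝ → ℝ) = 2 ^ Cardinal.continuum := by
  rw [rank_fun_infinite, ← Cardinal.power_def, Cardinal.mk_real]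
  exact Cardinal.power_self_eq Cardinal.aleph0_le_continuum
end
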